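/- Let A be a real n×m matrix, let t ≥ 1 be a natural number such that every nonzero x ∈ Ker(A) satisfies ‖x‖₀ ≥ 2t+1, and let 0 < u ≤ w be constants such that u‖z‖₂ ≤ ‖Az‖₂ ≤ w‖z‖₂ for every z ∈ ℝ^m with ‖z‖₀ ≤ 2t. Set r = w²/u². Then for every p with 0 < p ≤ 1, every index set τ₀ ⊆ {1,…,m} with |τ₀| = t, and every x ∈ Ker(A), one has ‖x_{τ₀}‖_p ≤ h* · ‖x_{τ₀^C}‖_p, where h* = ((√2+1)/2) · (t/(t+1))^{1/p} · [ (r−1)(m−2−t)/(2t) + (r + √(1/(t+1))) · t^{−1/2} ]. -/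

import Mathlib

/-- The number of nonzero entries of a vector (the "l0-norm"). -/
noncomputable def l0norm {m : ℕ} (x : Fin m → ℝ) : ℕ :=
  (Finset.univ.filter (fun i => x i ≠ 0)).card

/-- The Euclidean norm of a vector in `ℝ^k`. -/
noncomputable def l2norm {k : ℕ} (x : Fin k → ℝ) : ℝ :=
  Real.sqrt (∑ i, (x i) ^ 2)

open Finset in
theorem aux_top {α : Type*} [DecidableEq α] (f : α → ℝ) (S : Finset α) (k : ℕ) (hk : k ≤ S.card) :
    ∃ T ⊆ S, T.card = k ∧ ∀ i ∈ T, ∀ j ∈ S \ T, f j ≤ f i := by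
  induction k with
  | zero => exact ⟨∅, by simp, by simp, by simp⟩
  | succ k ih =>
    obtain ⟨T, hTS, hc, hT⟩ := ih (by omega)
    have hne : (S \ T).Nonempty := by
      rw [← Finset.card_pos, Finset.card_sdiff_of_subset hTS]; omega
    obtain ⟨a, ha, hmax⟩ := Finset.exists_max_image (S \ T) f hne
    have ha' := Finset.mem_sdiff.1 ha
    refine ⟨insert a T, Finset.insert_subset ha'.1 hTS, ?_, ?_⟩
    · rw [Finset.card_insert_of_notMem ha'.2, hc]
    · intro i hi j hj
      simp only [Finset.mem_sdiff, Finset.mem_insert, not_or] at hj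
      rcases Finset.mem_insert.1 hi with rfl | hi
      · exact hmax j (by simp [hj])
      · exact hT i hi j (by simp [hj])

/-- restriction of a vector to an index set -/
def auxRes {m : ℕ} (S : Finset (Fin m)) (x : Fin m → ℝ) : Fin m → ℝ :=
  fun i => if i ∈ S then x i else 0

theorem aux_l2sq {k : ℕ} (z : Fin k → ℝ) : l2norm z ^ 2 = ∑ i, z i ^ 2 :=
  Real.sq_sqrt (Finset.sum_nonneg fun _ _ => sq_nonneg _)

theorem aux_l2nn {k : ℕ} (z : Fin k → ℝ) : 0 ≤ l2norm z := Real.sqrt_nonneg _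

theorem aux_l2dot {k : ℕ} (z : Fin k → ℝ) : l2norm z ^ 2 = z ⬝ᵥ z := by
  rw [aux_l2sq]; simp [dotProduct, sq]

theorem aux_l0 {m : ℕ} (S : Finset (Fin m)) (z : Fin m → ℝ) (h : ∀ i ∉ S, z i = 0) :
    l0norm z ≤ S.card := by
  unfold l0norm
  apply Finset.card_le_card
  intro i hi
  by_contra hc
  exact (Finset.mem_filter.1 hi).2 (h i hc)

theorem aux_res_sq {m : ℕ} (S : Finset (Fin m)) (x : Fin m → ℝ) :
    l2norm (auxRes S x) ^ 2 = ∑ i ∈ S, x i ^ 2 := by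
  rw [aux_l2sq]
  simp [auxRes, ite_pow]

theorem aux_res_add {m : ℕ} (S T : Finset (Fin m)) (hd : Disjoint S T) (x : Fin m → ℝ) :
    auxRes (S ∪ T) x = auxRes S x + auxRes T x := by
  funext i
  have : i ∈ S → i ∉ T := fun q => Finset.disjoint_left.1 hd q
  by_cases h1 : i ∈ S <;> by_cases h2 : i ∈ T <;> simp_all [auxRes]

section
variable {n m : ℕ} (A : Matrix (Fin n) (Fin m) ℝ) (t : ℕ) (u w : ℝ)

theorem aux_orth (hu : 0 < u) (huw : u ≤ w)
    (hA : ∀ z : Fin m → ℝ, l0norm z ≤ 2 * t →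
      u * l2norm z ≤ l2norm (A.mulVec z) ∧ l2norm (A.mulVec z) ≤ w * l2norm z)
    (S T : Finset (Fin m)) (hd : Disjoint S T) (hS : S.card ≤ t) (hT : T.card ≤ t)
    (x y : Fin m → ℝ) :
    - (A.mulVec (auxRes S x) ⬝ᵥ A.mulVec (auxRes T y)) ≤
      (w ^ 2 - u ^ 2) / 2 * l2norm (auxRes S x) * l2norm (auxRes T y) := by
  set h := auxRes S x with hh
  set y' := auxRes T y with hy
  have H0 := aux_l2nn h
  have Y0 := aux_l2nn y'
  set H := l2norm h with hH
  set Y := l2norm y' with hY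
  have hdot : ∀ i, h i * y' i = 0 := by
    intro i
    have : i ∈ S → i ∉ T := fun q => Finset.disjoint_left.1 hd q
    by_cases h1 : i ∈ S <;> by_cases h2 : i ∈ T <;> simp_all [auxRes]
  have key : ∀ a b : ℝ, u ^ 2 * (a ^ 2 * H ^ 2 + b ^ 2 * Y ^ 2) ≤
        a ^ 2 * (A.mulVec h ⬝ᵥ A.mulVec h) + 2 * a * b * (A.mulVec h ⬝ᵥ A.mulVec y')
          + b ^ 2 * (A.mulVec y' ⬝ᵥ A.mulVec y') ∧
        a ^ 2 * (A.mulVec h ⬝ᵥ A.mulVec h) + 2 * a * b * (A.mulVec h ⬝ᵥ A.mulVec y')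
          + b ^ 2 * (A.mulVec y' ⬝ᵥ A.mulVec y') ≤ w ^ 2 * (a ^ 2 * H ^ 2 + b ^ 2 * Y ^ 2) := by
    intro a b
    have hz := hA (a • h + b • y') (by
      refine (aux_l0 (S ∪ T) _ ?_).trans ((Finset.card_union_le _ _).trans (by omega))
      intro i hi
      simp only [Finset.mem_union, not_or] at hi
      simp [hh, hy, auxRes, hi.1, hi.2])
    have e1 : l2norm (a • h + b • y') ^ 2 = a ^ 2 * H ^ 2 + b ^ 2 * Y ^ 2 := by
      rw [hH, hY, aux_l2sq, aux_l2sq, aux_l2sq, Finset.mul_sum, Finset.mul_sum,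
        ← Finset.sum_add_distrib]
      refine Finset.sum_congr rfl fun i _ => ?_
      simp only [Pi.add_apply, Pi.smul_apply, smul_eq_mul]
      linear_combination 2 * a * b * hdot i
    have e2 : l2norm (A.mulVec (a • h + b • y')) ^ 2 =
        a ^ 2 * (A.mulVec h ⬝ᵥ A.mulVec h) + 2 * a * b * (A.mulVec h ⬝ᵥ A.mulVec y')
          + b ^ 2 * (A.mulVec y' ⬝ᵥ A.mulVec y') := by
      rw [aux_l2dot, Matrix.mulVec_add, Matrix.mulVec_smul, Matrix.mulVec_smul]
      simp only [dotProduct_add, add_dotProduct, smul_dotProduct, dotProduct_smul, smul_eq_mul]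
      rw [dotProduct_comm (A.mulVec y') (A.mulVec h)]
      ring
    rw [← e1, ← e2, ← mul_pow, ← mul_pow]
    have := aux_l2nn (a • h + b • y')
    have := aux_l2nn (A.mulVec (a • h + b • y'))
    exact ⟨pow_le_pow_left₀ (by positivity) hz.1 2, pow_le_pow_left₀ (by positivity) hz.2 2⟩
  have k1 := (key Y H).1
  have k2 := (key Y (-H)).2
  have k3 := (key Y (-H)).1
  have zero : ∀ z : Fin m → ℝ, l2norm z = 0 → z = 0 := by
    intro z hz
    have := aux_l2sq z
    rw [hz] at this
    funext i
    have h2 := (Finset.sum_eq_zero_iff_of_nonneg (fun i _ => sq_nonneg (z i))).1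
      (by rw [← this]; norm_num) i (Finset.mem_univ i)
    simpa using h2
  rcases H0.eq_or_lt with h0 | h0
  · rw [← h0, zero h h0.symm]; simp
  rcases Y0.eq_or_lt with y0 | y0
  · rw [← y0, zero y' y0.symm]; simp
  have hp : 0 < H * Y := mul_pos h0 y0
  have : (H * Y) * (- (A.mulVec h ⬝ᵥ A.mulVec y')) ≤ (H * Y) * ((w ^ 2 - u ^ 2) / 2 * H * Y) := by
    nlinarith
  exact le_of_mul_le_mul_left this hp

theorem aux_blocks (hu : 0 < u) (huw : u ≤ w)
    (hA : ∀ z : Fin m → ℝ, l0norm z ≤ 2 * t →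
      u * l2norm z ≤ l2norm (A.mulVec z) ∧ l2norm (A.mulVec z) ≤ w * l2norm z)
    (S : Finset (Fin m)) (hS : S.card ≤ t) (x : Fin m → ℝ) (v : ℝ) (hv : 0 ≤ v) (K : ℕ) :
    ∀ R : Finset (Fin m), Disjoint S R → R.card ≤ K * t → (∀ i ∈ R, |x i| ≤ v) →
    - (A.mulVec (auxRes S x) ⬝ᵥ A.mulVec (auxRes R x)) ≤
      (w ^ 2 - u ^ 2) / 2 * l2norm (auxRes S x) * (K * (Real.sqrt t * v)) := by
  have hc : 0 ≤ (w ^ 2 - u ^ 2) / 2 * l2norm (auxRes S x) :=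
    mul_nonneg (by nlinarith) (aux_l2nn _)
  induction K with
  | zero =>
    intro R _ hR _
    have : R = ∅ := by simpa using hR
    subst this
    have : auxRes ∅ x = 0 := by funext i; simp [auxRes]
    simp [this]
  | succ K ih =>
    intro R hd hR hx
    obtain ⟨T, hTR, hT⟩ := Finset.exists_subset_card_eq (Nat.min_le_right t R.card)
    have e : R = T ∪ (R \ T) := (Finset.union_sdiff_of_subset hTR).symm
    have hTt : T.card ≤ t := by rw [hT]; exact Nat.min_le_left _ _
    have i1 := ih (R \ T) (hd.mono_right Finset.sdiff_subset) (by
      rw [Finset.card_sdiff_of_subset hTR, hT]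
      rw [Nat.add_mul] at hR
      omega) (fun i hi => hx i (Finset.mem_sdiff.1 hi).1)
    have i2 := aux_orth A t u w hu huw hA S T (hd.mono_right hTR) hS hTt x x
    have hn : l2norm (auxRes T x) ≤ Real.sqrt t * v := by
      apply le_of_sq_le_sq _ (by positivity)
      rw [aux_res_sq, mul_pow, Real.sq_sqrt (by positivity)]
      calc ∑ i ∈ T, x i ^ 2 ≤ ∑ i ∈ T, v ^ 2 := Finset.sum_le_sum fun i hi => by
            rw [← sq_abs]; exact pow_le_pow_left₀ (abs_nonneg _) (hx i (hTR hi)) 2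
        _ = T.card * v ^ 2 := by simp
        _ ≤ t * v ^ 2 := by gcongr
    have i3 := mul_le_mul_of_nonneg_left hn hc
    rw [e, aux_res_add T (R \ T) Finset.disjoint_sdiff, Matrix.mulVec_add, dotProduct_add]
    push_cast
    nlinarith

end

theorem aux_quad (a b D : ℝ) (hD : 0 ≤ D) (h : a ^ 2 + b ^ 2 ≤ D * (a + b)) :
    a ≤ (Real.sqrt 2 + 1) / 2 * D := by
  have h1 : (2 * a - D) ^ 2 ≤ (Real.sqrt 2 * D) ^ 2 := by
    rw [mul_pow, Real.sq_sqrt (by norm_num)]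
    nlinarith [sq_nonneg (2 * b - D)]
  have := abs_le_of_sq_le_sq' h1 (by positivity)
  linarith [this.2]

theorem aux_pm {ι : Type*} (S : Finset ι) (x : ι → ℝ) (p : ℝ) (hp : 0 < p) (hp1 : p ≤ 1)
    (hS : 0 < S.card) :
    (∑ i ∈ S, |x i| ^ p) ^ (1 / p) ≤
      (S.card : ℝ) ^ (1 / p) * (Real.sqrt (∑ i ∈ S, x i ^ 2) / Real.sqrt S.card) := by
  have hc : (0 : ℝ) < S.card := by exact_mod_cast hS
  have hs : 0 ≤ ∑ i ∈ S, |x i| ^ p := Finset.sum_nonneg fun i _ => by positivity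
  have h := Real.rpow_sum_le_const_mul_sum_rpow S (fun i => |x i| ^ p) (p := 2 / p)
    (by rw [le_div_iff₀ hp]; linarith)
  have e1 : ∀ i, |(|x i| ^ p)| = |x i| ^ p := fun i => abs_of_nonneg (by positivity)
  have e2 : ∀ i, (|x i| ^ p) ^ (2 / p) = x i ^ 2 := fun i => by
    rw [← Real.rpow_mul (abs_nonneg _), mul_div_cancel₀ _ hp.ne', Real.rpow_two, sq_abs]
  simp only [e1, e2] at h
  have h2 : ∀ y : ℝ, 0 ≤ y → y ^ (2 / p) = (y ^ (1 / p)) ^ 2 := fun y hy => by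
    rw [← Real.rpow_two, ← Real.rpow_mul hy]; congr 1; ring
  rw [h2 _ hs, Real.rpow_sub hc, h2 _ hc.le, Real.rpow_one] at h
  apply le_of_sq_le_sq _ (by positivity)
  rw [mul_pow, div_pow, Real.sq_sqrt (Finset.sum_nonneg fun i _ => sq_nonneg _),
    Real.sq_sqrt hc.le]
  calc _ ≤ _ := h
    _ = _ := by ring

/-- Theorem 3: under the null-space hypothesis `‖x‖₀ ≥ 2t+1` for nonzero
kernel vectors and restricted frame bounds `u ‖z‖₂ ≤ ‖A z‖₂ ≤ w ‖z‖₂` for `‖z‖₀ ≤ 2t`,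
with `r = w²/u²`, for every `0 < p ≤ 1`, every index set `τ₀` with `|τ₀| = t`, and every
`x ∈ Ker A`, one has `‖x_{τ₀}‖_p ≤ h* · ‖x_{τ₀ᶜ}‖_p` with
`h* = ((√2+1)/2) (t/(t+1))^(1/p) [ (r−1)(m−2−t)/(2t) + (r + √(1/(t+1))) t^(−1/2) ]`. -/
theorem stmt11 (n m : ℕ) (A : Matrix (Fin n) (Fin m) ℝ) (t : ℕ) (ht : 1 ≤ t)
    (hker : ∀ x : Fin m → ℝ, x ≠ 0 → A.mulVec x = 0 → 2 * t + 1 ≤ l0norm x)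
    (u w : ℝ) (hu : 0 < u) (huw : u ≤ w)
    (hA : ∀ z : Fin m → ℝ, l0norm z ≤ 2 * t →
      u * l2norm z ≤ l2norm (A.mulVec z) ∧ l2norm (A.mulVec z) ≤ w * l2norm z) :
    ∀ p : ℝ, 0 < p → p ≤ 1 →
      ∀ τ₀ : Finset (Fin m), τ₀.card = t →
        ∀ x : Fin m → ℝ, A.mulVec x = 0 →
          (∑ i ∈ τ₀, |x i| ^ p) ^ (1 / p) ≤
            ((Real.sqrt 2 + 1) / 2 * ((t : ℝ) / (t + 1)) ^ (1 / p) *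
              ((w ^ 2 / u ^ 2 - 1) * ((m : ℝ) - 2 - t) / (2 * t) +
                (w ^ 2 / u ^ 2 + Real.sqrt (1 / ((t : ℝ) + 1))) * (t : ℝ) ^ (-(1 : ℝ) / 2))) *
            (∑ i ∈ τ₀ᶜ, |x i| ^ p) ^ (1 / p) := by
  intro p hp hp1 τ hτ x hx
  have ht0 : (0 : ℝ) < t := by exact_mod_cast ht
  by_cases hx0 : x = 0
  · subst hx0
    simp [Real.zero_rpow hp.ne', Real.zero_rpow (inv_pos.2 hp).ne']
  have hm : 2 * t + 1 ≤ m := (hker x hx0 hx).trans (by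
    have := Finset.card_le_univ (Finset.univ.filter (fun i => x i ≠ 0))
    simpa [l0norm] using this)
  have hcc : τᶜ.card = m - t := by rw [Finset.card_compl, hτ]; simp
  obtain ⟨T, hTs, hTc, hT⟩ := aux_top (fun i => |x i|) τᶜ t (by omega)
  have hRc : (τᶜ \ T).card = m - 2 * t := by
    rw [Finset.card_sdiff_of_subset hTs, hcc, hTc]; omega
  obtain ⟨a, ha, hmax⟩ := Finset.exists_max_image (τᶜ \ T) (fun i => |x i|)
    (by rw [← Finset.card_pos]; omega)
  set R := τᶜ \ T with hR
  set v := |x a| with hv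
  have hv0 : 0 ≤ v := abs_nonneg _
  have ha' := Finset.mem_sdiff.1 ha
  -- lower bound of the tail
  have hlow : ((t : ℝ) + 1) ^ (1 / p) * v ≤ (∑ i ∈ τᶜ, |x i| ^ p) ^ (1 / p) := by
    have : ((t : ℝ) + 1) * v ^ p ≤ ∑ i ∈ τᶜ, |x i| ^ p := by
      calc ((t : ℝ) + 1) * v ^ p = ∑ i ∈ insert a T, v ^ p := by
            rw [Finset.sum_const, Finset.card_insert_of_notMem ha'.2, hTc]; simp
        _ ≤ ∑ i ∈ insert a T, |x i| ^ p := Finset.sum_le_sum fun i hi => by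
            rcases Finset.mem_insert.1 hi with rfl | hi
            · exact le_rfl
            · exact Real.rpow_le_rpow hv0 (hT i hi a ha) hp.le
        _ ≤ _ := Finset.sum_le_sum_of_subset_of_nonneg (Finset.insert_subset ha'.1 hTs)
            fun i _ _ => by positivity
    calc ((t : ℝ) + 1) ^ (1 / p) * v = (((t : ℝ) + 1) * v ^ p) ^ (1 / p) := by
          rw [Real.mul_rpow (by positivity) (by positivity), ← Real.rpow_mul hv0,
            mul_one_div_cancel hp.ne', Real.rpow_one]
      _ ≤ _ := Real.rpow_le_rpow (by positivity) this (by positivity)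
  obtain ⟨K, hK1, hK2⟩ : ∃ K : ℕ, m - 2 * t ≤ K * t ∧ K * t + t + 1 ≤ m := by
    refine ⟨(m - t - 1) / t, ?_, ?_⟩
    · have := Nat.lt_div_mul_add (a := m - t - 1) (b := t) (by omega)
      omega
    · have := Nat.div_mul_le_self (m - t - 1) t
      omega
  have dτT : Disjoint τ T := Finset.disjoint_left.2 fun i hi hi' =>
    (Finset.mem_compl.1 (hTs hi')) hi
  have dτR : Disjoint τ R := Finset.disjoint_left.2 fun i hi hi' =>
    (Finset.mem_compl.1 (Finset.mem_sdiff.1 hi').1) hi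
  have dTR : Disjoint T R := Finset.disjoint_sdiff
  have b1 := aux_blocks A t u w hu huw hA τ hτ.le x v hv0 K R dτR (by omega) hmax
  have b2 := aux_blocks A t u w hu huw hA T hTc.le x v hv0 K R dTR (by omega) hmax
  have hsplit : x = auxRes τ x + auxRes T x + auxRes R x := by
    rw [← aux_res_add τ T dτT, ← aux_res_add (τ ∪ T) R (Finset.disjoint_union_left.2 ⟨dτR, dTR⟩)]
    funext i
    have : i ∈ τ ∪ T ∪ R := by
      simp only [hR, Finset.mem_union, Finset.mem_sdiff, Finset.mem_compl]; tauto
    simp only [auxRes, if_pos this]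
  have hlo := (hA (auxRes (τ ∪ T) x) ((aux_l0 (τ ∪ T) _ (by
    intro i hi; simp only [auxRes, if_neg hi])).trans
      ((Finset.card_union_le _ _).trans (by omega)))).1
  have hlo2 := pow_le_pow_left₀ (mul_nonneg hu.le (aux_l2nn _)) hlo 2
  rw [mul_pow, aux_res_sq, Finset.sum_union dτT, ← aux_res_sq, ← aux_res_sq, aux_l2dot (A.mulVec _),
    aux_res_add τ T dτT] at hlo2
  have hAz : A.mulVec (auxRes τ x + auxRes T x) = - A.mulVec (auxRes R x) := by
    rw [eq_neg_iff_add_eq_zero, ← Matrix.mulVec_add, ← hsplit, hx]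
  have hdot : A.mulVec (auxRes τ x + auxRes T x) ⬝ᵥ A.mulVec (auxRes τ x + auxRes T x) =
      - (A.mulVec (auxRes τ x) ⬝ᵥ A.mulVec (auxRes R x))
      + - (A.mulVec (auxRes T x) ⬝ᵥ A.mulVec (auxRes R x)) := by
    nth_rewrite 2 [hAz]
    rw [Matrix.mulVec_add, dotProduct_neg, add_dotProduct]; ring
  rw [hdot] at hlo2
  set a0 := l2norm (auxRes τ x) with ha0
  set b0 := l2norm (auxRes T x)
  set s := Real.sqrt t with hs
  have hs0 : 0 < s := Real.sqrt_pos.2 ht0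
  have hs2 : s ^ 2 = t := Real.sq_sqrt ht0.le
  have hs1 : 1 ≤ s := Real.one_le_sqrt.2 (by exact_mod_cast ht)
  set r := w ^ 2 / u ^ 2 with hr
  have hu2 : 0 < u ^ 2 := by positivity
  have hr1 : 1 ≤ r := by
    rw [hr, one_le_div hu2]; exact pow_le_pow_left₀ hu.le huw 2
  have hwr : w ^ 2 = r * u ^ 2 := by rw [hr]; field_simp
  have hq : a0 ^ 2 + b0 ^ 2 ≤ ((r - 1) / 2 * (K * (s * v))) * (a0 + b0) := by
    rw [hwr] at b1 b2
    refine le_of_mul_le_mul_left ?_ hu2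
    linarith
  have hr0 : 0 ≤ r - 1 := by linarith
  have hfin := aux_quad a0 b0 _ (by positivity) hq
  have hpm := aux_pm τ x p hp hp1 (by omega)
  rw [hτ, ← aux_res_sq, Real.sqrt_sq (aux_l2nn _), ← hs, ← ha0] at hpm
  have hts : (t : ℝ) ^ (-(1 : ℝ) / 2) = 1 / s := by
    rw [hs, Real.sqrt_eq_rpow, neg_div, Real.rpow_neg ht0.le, one_div, one_div]
  rw [hts, Real.div_rpow ht0.le (by positivity)]
  set q := Real.sqrt (1 / ((t : ℝ) + 1)) with hqq
  have hq0 : 0 ≤ q := Real.sqrt_nonneg _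
  have hKm : (K : ℝ) * t + t + 1 ≤ m := by exact_mod_cast hK2
  set E := (r - 1) * ((m : ℝ) - 2 - t) / (2 * t) + (r + q) * (1 / s) with hE
  have hKE : (r - 1) / 2 * K ≤ E := by
    have e1 : (r - 1) / 2 * K ≤ (r - 1) * ((m : ℝ) - 2 - t) / (2 * t) + (r - 1) / (2 * t) := by
      rw [← add_div, le_div_iff₀ (by positivity)]
      have := mul_nonneg hr0 (sub_nonneg.2 hKm)
      linarith
    have e2 : (r - 1) / (2 * t) ≤ (r + q) * (1 / s) := by
      rw [mul_one_div, ← hs2]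
      have hss : s ≤ 2 * s ^ 2 := by nlinarith only [hs1]
      exact div_le_div₀ (by linarith) (by linarith) hs0 hss
    linarith
  have hE0 : 0 ≤ E := le_trans (by positivity) hKE
  have hP : 0 < ((t : ℝ) + 1) ^ (1 / p) := by positivity
  have hc0 : 0 ≤ (Real.sqrt 2 + 1) / 2 := by positivity
  have has : a0 / s ≤ (Real.sqrt 2 + 1) / 2 * (E * v) := by
    rw [div_le_iff₀ hs0]
    have := mul_le_mul_of_nonneg_right hKE (mul_nonneg hs0.le hv0)
    have := mul_le_mul_of_nonneg_left this hc0
    linarith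
  calc _ ≤ _ := hpm
    _ ≤ (t : ℝ) ^ (1 / p) * ((Real.sqrt 2 + 1) / 2 * (E * v)) := by gcongr
    _ = ((Real.sqrt 2 + 1) / 2 * ((t : ℝ) ^ (1 / p) / ((t : ℝ) + 1) ^ (1 / p)) * E) *
        (((t : ℝ) + 1) ^ (1 / p) * v) := by field_simp
    _ ≤ _ := by gcongr
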